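/- arXiv:2304.01176 — 3 statements merged into one kernel-verified Lean document; each statement's English description precedes it below -/
import Mathlib

section
/- For any subsets X, Y, Z ⊆ [0, 1] of the real line, |(X + Y) ∪ ({0, 1} + Z)| ≥ min{1, |X| + |Y|} + |Z|, where |·| denotes Lebesgue outer measure on ℝ. -/
open MeasureTheory Pointwise
open Filter Topology Metric
open scoped ENNReal

namespace UnitAddCircle

lemma exists_mem_closedBall_toAddCircle (p : ℕ) [NeZero p] (x : UnitAddCircle) :
    ∃ k : ZMod p, x ∈ closedBall (ZMod.toAddCircle k) (1 / (2 * p)) := by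
  obtain ⟨x, rfl⟩ := QuotientAddGroup.mk_surjective x
  have hp : (0 : ℝ) < p := Nat.cast_pos.mpr (NeZero.pos p)
  refine ⟨(round (x * p) : ℤ), ?_⟩
  rw [mem_closedBall, dist_eq_norm, ZMod.toAddCircle_intCast]
  calc ‖((x : ℝ) : UnitAddCircle) - ((round (x * p) / p : ℝ) : UnitAddCircle)‖
      = ‖((x - round (x * p) / p : ℝ) : UnitAddCircle)‖ := by rw [AddCircle.coe_sub]
    _ ≤ |x - round (x * p) / p| := by
        rw [UnitAddCircle.norm_eq]
        simpa using round_le (x - round (x * p) / p) 0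
    _ = |x * p - round (x * p)| / p := by
        rw [← abs_of_pos hp, ← abs_div, abs_of_pos hp]
        congr 1
        field_simp
    _ ≤ (1 / 2) / p := by
        gcongr
        exact abs_sub_round _
    _ = 1 / (2 * p) := by field_simp

lemma one_div_le_norm_toAddCircle {p : ℕ} [NeZero p] {k : ZMod p} (hk : k ≠ 0) :
    1 / (p : ℝ) ≤ ‖(ZMod.toAddCircle k : UnitAddCircle)‖ := by
  have hp : 0 < p := NeZero.pos p
  have h0 : p • (ZMod.toAddCircle k : UnitAddCircle) = 0 := by
    rw [← map_nsmul]; simp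
  have hfin : IsOfFinAddOrder (ZMod.toAddCircle k : UnitAddCircle) :=
    isOfFinAddOrder_iff_nsmul_eq_zero.mpr ⟨p, hp, h0⟩
  have h1 := AddCircle.le_add_order_smul_norm_of_isOfFinAddOrder hfin
    (by simpa using hk)
  have h2 : addOrderOf (ZMod.toAddCircle k : UnitAddCircle) ≤ p :=
    addOrderOf_le_of_nsmul_eq_zero hp h0
  rw [div_le_iff₀ (by exact_mod_cast hp), mul_comm]
  refine h1.trans ?_
  rw [nsmul_eq_mul]
  gcongr

lemma volume_closedBall_cell {p : ℕ} (hp : 0 < p) (x : UnitAddCircle) :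
    volume (closedBall x (1 / (2 * p))) = ENNReal.ofReal (1 / p) := by
  have : (1 : ℝ) ≤ p := by exact_mod_cast hp
  rw [AddCircle.volume_closedBall, min_eq_right]
  · congr 1; field_simp
  · rw [show 2 * (1 / (2 * (p : ℝ))) = 1 / p by field_simp]
    exact (div_le_one (by linarith)).mpr this

lemma card_mul_le_volume_biUnion {p : ℕ} [NeZero p] (C : Finset (ZMod p)) :
    C.card * ENNReal.ofReal (1 / p) ≤
      volume (⋃ k ∈ C, closedBall (ZMod.toAddCircle k : UnitAddCircle) (1 / (2 * p))) := by
  have hp : 0 < p := NeZero.pos p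
  have hp' : (0 : ℝ) < p := by exact_mod_cast hp
  calc C.card * ENNReal.ofReal (1 / p)
      = ∑ k ∈ C, volume (ball (ZMod.toAddCircle k : UnitAddCircle) (1 / (2 * p))) := by
        simp_rw [← measure_congr (AddCircle.closedBall_ae_eq_ball (T := 1)),
          volume_closedBall_cell hp]
        simp
    _ = volume (⋃ k ∈ C, ball (ZMod.toAddCircle k : UnitAddCircle) (1 / (2 * p))) := by
        rw [measure_biUnion_finset _ fun _ _ => measurableSet_ball]
        intro k _ l _ hkl
        apply ball_disjoint_ball
        rw [dist_eq_norm, ← map_sub]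
        refine le_trans (le_of_eq ?_) (one_div_le_norm_toAddCircle (sub_ne_zero.mpr hkl))
        field_simp
        norm_num
    _ ≤ _ := by
        gcongr
        exact ball_subset_closedBall

/-- The cells of the `p`-th uniform subdivision of the circle that meet `A`. -/
noncomputable def cells (p : ℕ) [NeZero p] (A : Set UnitAddCircle) : Finset (ZMod p) :=
  open Classical in
  {k | (A ∩ closedBall (ZMod.toAddCircle k : UnitAddCircle) (1 / (2 * p))).Nonempty}

lemma mem_cells {p : ℕ} [NeZero p] {A : Set UnitAddCircle} {k : ZMod p} :
    k ∈ cells p A ↔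
      (A ∩ closedBall (ZMod.toAddCircle k : UnitAddCircle) (1 / (2 * p))).Nonempty := by
  simp [cells]

lemma cells_nonempty {p : ℕ} [NeZero p] {A : Set UnitAddCircle} (hA : A.Nonempty) :
    (cells p A).Nonempty := by
  obtain ⟨a, ha⟩ := hA
  obtain ⟨k, hk⟩ := exists_mem_closedBall_toAddCircle p a
  exact ⟨k, mem_cells.mpr ⟨a, ha, hk⟩⟩

lemma volume_le_card_cells {p : ℕ} [NeZero p] (A : Set UnitAddCircle) :
    volume A ≤ (cells p A).card * ENNReal.ofReal (1 / p) := by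
  calc volume A
      ≤ volume (⋃ k ∈ cells p A,
          closedBall (ZMod.toAddCircle k : UnitAddCircle) (1 / (2 * p))) := by
        apply measure_mono
        intro a ha
        obtain ⟨k, hk⟩ := exists_mem_closedBall_toAddCircle p a
        exact Set.mem_biUnion (mem_cells.mpr ⟨a, ha, hk⟩) hk
    _ ≤ ∑ k ∈ cells p A, volume (closedBall (ZMod.toAddCircle k : UnitAddCircle) (1 / (2 * p))) :=
        measure_biUnion_finset_le _ _
    _ = _ := by
        simp_rw [volume_closedBall_cell (NeZero.pos p)]
        simp

lemma min_one_le_volume_cthickening_add {p : ℕ} (hp : p.Prime) {A B : Set UnitAddCircle}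
    (hA : A.Nonempty) (hB : B.Nonempty) :
    min 1 (volume A + volume B) ≤
      volume (cthickening (2 / p) (A + B)) + ENNReal.ofReal (1 / p) := by
  have : NeZero p := ⟨hp.ne_zero⟩
  have hp0 : (0 : ℝ) < p := by exact_mod_cast hp.pos
  have hsub : (⋃ k ∈ cells p A + cells p B,
      closedBall (ZMod.toAddCircle k : UnitAddCircle) (1 / (2 * p))) ⊆
      cthickening (2 / p) (A + B) := by
    intro x hx
    simp only [Set.mem_iUnion] at hx
    obtain ⟨k, hk, hx⟩ := hx
    obtain ⟨i, hi, j, hj, rfl⟩ := Finset.mem_add.mp hk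
    obtain ⟨a, ha, hai⟩ := mem_cells.mp hi
    obtain ⟨b, hb, hbj⟩ := mem_cells.mp hj
    refine mem_cthickening_of_dist_le x (a + b) _ _ (Set.add_mem_add ha hb) ?_
    rw [mem_closedBall] at hx hai hbj
    calc dist x (a + b)
        ≤ dist x (ZMod.toAddCircle (i + j)) + dist (a + b) (ZMod.toAddCircle (i + j)) :=
          dist_triangle_right _ _ _
      _ ≤ 1 / (2 * p) + (1 / (2 * p) + 1 / (2 * p)) := by
          rw [map_add] at hx ⊢
          exact add_le_add hx ((dist_add_add_le _ _ _ _).trans (add_le_add hai hbj))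
      _ ≤ 2 / p := by
          field_simp
          norm_num
  have hcd := ZMod.cauchy_davenport hp (cells_nonempty (p := p) hA) (cells_nonempty (p := p) hB)
  have hcd' : p ≤ (cells p A + cells p B).card + 1 ∨
      (cells p A).card + (cells p B).card ≤ (cells p A + cells p B).card + 1 := by
    rw [min_le_iff] at hcd
    omega
  have hvol := (card_mul_le_volume_biUnion (cells p A + cells p B)).trans (measure_mono hsub)
  refine le_trans ?_ (add_le_add_left hvol _)
  rw [← add_one_mul]
  rcases hcd' with h | h
  · refine (min_le_left _ _).trans ?_
    calc (1 : ℝ≥0∞) = p * ENNReal.ofReal (1 / p) := by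
          rw [← ENNReal.ofReal_natCast, ← ENNReal.ofReal_mul hp0.le, mul_one_div_cancel hp0.ne',
            ENNReal.ofReal_one]
      _ ≤ _ := by
          gcongr
          exact_mod_cast h
  · refine (min_le_right _ _).trans ?_
    refine (add_le_add (volume_le_card_cells (p := p) A) (volume_le_card_cells (p := p) B)).trans ?_
    rw [← add_mul]
    exact mul_le_mul' (by exact_mod_cast h) le_rfl

lemma min_one_le_volume_closure_add {A B : Set UnitAddCircle}
    (hA : A.Nonempty) (hB : B.Nonempty) :
    min 1 (volume A + volume B) ≤ volume (closure (A + B)) := by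
  choose p hnp hp using Nat.exists_infinite_primes
  have hlim : Tendsto (fun n => (p n : ℝ)) atTop atTop :=
    tendsto_natCast_atTop_atTop.comp (tendsto_atTop_mono hnp tendsto_id)
  have h1 : Tendsto (fun n => volume (cthickening (2 / (p n : ℝ)) (A + B))) atTop
      (𝓝 (volume (closure (A + B)))) :=
    (tendsto_measure_cthickening ⟨1, one_pos, measure_ne_top _ _⟩).comp
      (hlim.const_div_atTop 2)
  have h2 : Tendsto (fun n => ENNReal.ofReal (1 / (p n : ℝ))) atTop (𝓝 0) := by
    simpa using ENNReal.tendsto_ofReal (hlim.const_div_atTop 1)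
  have h3 := h1.add h2
  rw [add_zero] at h3
  exact ge_of_tendsto' h3 fun n => min_one_le_volume_cthickening_add (hp n) hA hB

/-- The points around which `S` has density at least `c` at scale `r`. -/
def densePoints (c : ℝ≥0∞) (r : ℝ) (S : Set UnitAddCircle) : Set UnitAddCircle :=
  {x | c * volume (closedBall (0 : UnitAddCircle) r) ≤ volume (S ∩ closedBall x r)}

lemma isClosed_densePoints (c : ℝ≥0∞) (r : ℝ) {S : Set UnitAddCircle} (hS : MeasurableSet S) :
    IsClosed (densePoints c r S) := by
  refine isClosed_of_closure_subset fun x hx => ?_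
  have hle : ∀ r' > r, c * volume (closedBall (0 : UnitAddCircle) r) ≤
      volume (S ∩ closedBall x r') := by
    intro r' hr'
    obtain ⟨y, hy, hxy⟩ := Metric.mem_closure_iff.mp hx (r' - r) (sub_pos.mpr hr')
    refine le_trans hy (measure_mono (Set.inter_subset_inter_right _ ?_))
    apply closedBall_subset_closedBall'
    rw [dist_comm]
    linarith
  have hlim : Tendsto (fun r' => volume (S ∩ closedBall x r')) (𝓝[>] r)
      (𝓝 (volume (⋂ r' > r, S ∩ closedBall x r'))) :=
    tendsto_measure_biInter_gt
      (fun _ _ => (hS.inter measurableSet_closedBall).nullMeasurableSet)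
      (fun i j _ hij => Set.inter_subset_inter_right _ (closedBall_subset_closedBall hij))
      ⟨r + 1, by simp, measure_ne_top _ _⟩
  have hInter : (⋂ r' > r, S ∩ closedBall x r') ⊆ S ∩ closedBall x r := by
    intro y hy
    simp only [Set.mem_iInter] at hy
    refine ⟨(hy (r + 1) (by simp)).1, ?_⟩
    exact le_of_forall_gt_imp_ge_of_dense fun r' hr' => (hy r' hr').2
  exact (ge_of_tendsto hlim (eventually_mem_nhdsWithin.mono fun r' hr' => hle r' hr')).trans
    (measure_mono hInter)

lemma densePoints_add_subset (c : ℝ≥0∞) (r : ℝ) {A B W : Set UnitAddCircle} (h : A + B ⊆ W) :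
    densePoints c r A + B ⊆ densePoints c r W := by
  rintro _ ⟨a, ha, b, hb, rfl⟩
  have ha' : c * volume (closedBall (0 : UnitAddCircle) r) ≤
      volume (A ∩ closedBall a r) := ha
  refine ha'.trans ?_
  rw [← measure_preimage_add_right volume (-b) (A ∩ closedBall a r)]
  apply measure_mono
  rintro x ⟨hxA, hxa⟩
  refine ⟨h ⟨x + -b, hxA, b, hb, by simp⟩, ?_⟩
  rw [mem_closedBall, dist_eq_norm] at hxa ⊢
  rwa [show x - (a + b) = x + -b - a by abel]

lemma mul_volume_densePoints_le (c : ℝ≥0∞) {r : ℝ} (hr : 0 < r) {W : Set UnitAddCircle}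
    (hW : MeasurableSet W) : c * volume (densePoints c r W) ≤ volume W := by
  set v := volume (closedBall (0 : UnitAddCircle) r) with hv
  have hv0 : v ≠ 0 := (measure_closedBall_pos _ _ hr).ne'
  have hvtop : v ≠ ∞ := measure_ne_top _ _
  have hball : ∀ x : UnitAddCircle, volume (closedBall x r) = v := fun x => by
    rw [hv, AddCircle.volume_closedBall, AddCircle.volume_closedBall]
  let S : Set (UnitAddCircle × UnitAddCircle) := {q | q.2 ∈ W ∧ dist q.2 q.1 ≤ r}
  have hS : MeasurableSet S :=
    (measurable_snd hW).inter (measurableSet_le (measurable_snd.dist measurable_fst)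
      measurable_const)
  have hsec : ∀ x, Prod.mk x ⁻¹' S = W ∩ closedBall x r := fun x => rfl
  have hmeas : Measurable fun x => volume (W ∩ closedBall x r) :=
    measurable_measure_prodMk_left hS
  have hint : ∫⁻ x, volume (W ∩ closedBall x r) = volume W * v := by
    calc ∫⁻ x, volume (W ∩ closedBall x r)
        = (volume.prod volume) S := (Measure.prod_apply hS).symm
      _ = ∫⁻ y, volume ((fun x => (x, y)) ⁻¹' S) := Measure.prod_apply_symm hS
      _ = ∫⁻ y, W.indicator (fun _ => v) y := by
          congr 1 with y
          by_cases hy : y ∈ W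
          · rw [Set.indicator_of_mem hy, ← hball y]
            congr 1 with x
            simp [S, hy, dist_comm]
          · rw [Set.indicator_of_notMem hy]
            simp [S, hy]
      _ = volume W * v := by rw [lintegral_indicator_const hW, mul_comm]
  have hmarkov := mul_meas_ge_le_lintegral (μ := volume) hmeas (c * v)
  rw [hint] at hmarkov
  rw [← ENNReal.mul_le_mul_iff_left hv0 hvtop]
  calc c * volume (densePoints c r W) * v = c * v * volume (densePoints c r W) := by ring
    _ ≤ _ := hmarkov

lemma mul_min_one_densePoints_le (c : ℝ≥0∞) (hc : c ≤ 1) {r : ℝ} (hr : 0 < r)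
    {A B : Set UnitAddCircle} (hA : A.Nonempty) (hB : B.Nonempty) :
    c * min 1 (volume (densePoints c r A) + volume B) ≤ volume (A + B) := by
  rcases (densePoints c r A).eq_empty_or_nonempty with h | h
  · obtain ⟨a, ha⟩ := hA
    rw [h, measure_empty, zero_add]
    calc c * min 1 (volume B) ≤ 1 * volume B := mul_le_mul' hc (min_le_right _ _)
      _ = volume ((fun x => -a + x) ⁻¹' B) := by rw [one_mul, measure_preimage_add]
      _ ≤ volume (A + B) := measure_mono fun x hx => ⟨a, ha, -a + x, hx, by simp⟩
  · have hW := measurableSet_toMeasurable volume (A + B)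
    rw [← measure_toMeasurable (A + B)]
    refine le_trans ?_ (mul_volume_densePoints_le c hr hW)
    gcongr
    refine (min_one_le_volume_closure_add h hB).trans (measure_mono ?_)
    exact closure_minimal (densePoints_add_subset c r (subset_toMeasurable _ _))
      (isClosed_densePoints c r hW)

lemma ae_eventually_mem_densePoints {c : ℝ≥0∞} (hc : c < 1) {u : ℕ → ℝ}
    (hu : Tendsto u atTop (𝓝[>] 0)) (A : Set UnitAddCircle) :
    ∀ᵐ x ∂(volume.restrict A), ∀ᶠ n in atTop, x ∈ densePoints c (u n) A := by
  filter_upwards [IsUnifLocDoublingMeasure.ae_tendsto_measure_inter_div volume A 1] with x hx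
  have hpos : ∀ᶠ n in atTop, 0 < u n := hu.eventually_mem self_mem_nhdsWithin
  have h := hx (fun _ => x) u hu (hpos.mono fun n hn => by simpa using hn.le)
  filter_upwards [h.eventually_const_lt hc, hpos] with n hn hn0
  have hb : volume (closedBall x (u n)) = volume (closedBall (0 : UnitAddCircle) (u n)) := by
    rw [AddCircle.volume_closedBall, AddCircle.volume_closedBall]
  rw [densePoints, Set.mem_ofPred_eq, ← hb]
  exact ((ENNReal.lt_div_iff_mul_lt (Or.inl (measure_closedBall_pos _ _ hn0).ne')
    (Or.inl (measure_ne_top _ _))).mp hn).le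

/-- The **Raikov–Macbeath inequality** for the outer measure of a sumset in the circle. -/
theorem min_one_le_volume_add {A B : Set UnitAddCircle} (hA : A.Nonempty) (hB : B.Nonempty) :
    min 1 (volume A + volume B) ≤ volume (A + B) := by
  refine ENNReal.le_of_forall_lt_one_mul_le fun c hc => ?_
  let u : ℕ → ℝ := fun n => 1 / ((n : ℝ) + 1)
  have hu0 : ∀ n, 0 < u n := fun n => Nat.one_div_pos_of_nat
  have hu : Tendsto u atTop (𝓝[>] 0) :=
    tendsto_nhdsWithin_iff.mpr ⟨tendsto_one_div_add_atTop_nhds_zero_nat, .of_forall hu0⟩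
  let E : ℕ → Set UnitAddCircle := fun N => ⋂ n ≥ N, densePoints c (u n) A
  have hE : Monotone E := fun M N hMN =>
    Set.biInter_mono (fun n hn => le_trans hMN hn) fun _ _ => subset_rfl
  have hAE : volume A ≤ volume (⋃ N, E N) := by
    have hae : ∀ᵐ x ∂(volume.restrict A), x ∈ ⋃ N, E N := by
      filter_upwards [ae_eventually_mem_densePoints hc hu A] with x hx
      simpa [E, eventually_atTop] using hx
    calc volume A = volume.restrict A Set.univ := by simp
      _ ≤ volume.restrict A (⋃ N, E N) := measure_mono_ae (hae.mono fun x hx _ => hx)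
      _ ≤ volume (⋃ N, E N) := Measure.restrict_apply_le _ _
  have hlim : Tendsto (fun N => c * min 1 (volume (E N) + volume B)) atTop
      (𝓝 (c * min 1 (volume (⋃ N, E N) + volume B))) :=
    ENNReal.Tendsto.const_mul
      (tendsto_const_nhds.min ((tendsto_measure_iUnion_atTop hE).add tendsto_const_nhds))
      (Or.inr hc.ne_top)
  calc c * min 1 (volume A + volume B) ≤ c * min 1 (volume (⋃ N, E N) + volume B) := by gcongr
    _ ≤ volume (A + B) := le_of_tendsto' hlim fun N => by
        refine le_trans ?_ (mul_min_one_densePoints_le c hc.le (hu0 N) hA hB)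
        gcongr
        exact Set.biInter_subset_of_mem (Set.mem_Ici.mpr le_rfl)

lemma volume_le_volume_image_coe {X : Set ℝ} (hX : X ⊆ Set.Icc 0 1) :
    volume X ≤ volume ((fun x : ℝ => (x : UnitAddCircle)) '' X) := by
  calc volume X = volume (X ∩ Set.Icc 0 1) := by rw [Set.inter_eq_left.mpr hX]
    _ = volume.restrict (Set.Ioc 0 (0 + 1)) X := by
        rw [← Measure.restrict_apply' measurableSet_Icc, zero_add,
          restrict_Ioc_eq_restrict_Icc]
    _ ≤ volume.restrict (Set.Ioc 0 (0 + 1))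
          ((fun x : ℝ => (x : UnitAddCircle)) ⁻¹' ((fun x : ℝ => (x : UnitAddCircle)) '' X)) :=
        measure_mono (Set.subset_preimage_image _ _)
    _ ≤ volume ((fun x : ℝ => (x : UnitAddCircle)) '' X) := by
        have h := UnitAddCircle.measurePreserving_mk 0
        rw [← h.map_eq]
        exact Measure.le_map_apply h.measurable.aemeasurable _

lemma volume_image_coe_le {D : Set ℝ} (hD : MeasurableSet D) (hD' : D ⊆ Set.Ioc 0 1) :
    volume ((fun x : ℝ => (x : UnitAddCircle)) '' D) ≤ volume D := by
  let e := AddCircle.measurableEquivIoc (1 : ℝ) 0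
  let V : Set UnitAddCircle := e ⁻¹' (Subtype.val ⁻¹' D)
  have hV : MeasurableSet V := e.measurable (measurable_subtype_coe hD)
  have he : ∀ x (hx : x ∈ Set.Ioc (0 : ℝ) (0 + 1)), e (x : UnitAddCircle) = ⟨x, hx⟩ :=
    fun x hx => e.apply_symm_apply ⟨x, hx⟩
  have hDV : (fun x : ℝ => (x : UnitAddCircle)) '' D ⊆ V := by
    rintro _ ⟨x, hx, rfl⟩
    have hx' : x ∈ Set.Ioc (0 : ℝ) (0 + 1) := by simpa using hD' hx
    simpa [V, he x hx'] using hx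
  refine (measure_mono hDV).trans ?_
  rw [AddCircle.add_projection_respects_measure 1 0 hV]
  apply measure_mono
  rintro x ⟨hxV, hx⟩
  have : ((e (x : UnitAddCircle) : Set.Ioc (0 : ℝ) (0 + 1)) : ℝ) ∈ D := hxV
  rwa [he x hx] at this

end UnitAddCircle

/-- **Key one-dimensional lemma for distinct sets.**
For nonempty `X, Y, Z ⊆ [0, 1]` one has
`|(X + Y) ∪ ({0,1} + Z)| ≥ min{1, |X| + |Y|} + |Z|`
(Lebesgue outer measure on `ℝ`). -/
theorem union_sumset_lower_bound (X Y Z : Set ℝ)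
    (hX : X ⊆ Set.Icc 0 1) (hY : Y ⊆ Set.Icc 0 1) (hZ : Z ⊆ Set.Icc 0 1)
    (hXne : X.Nonempty) (hYne : Y.Nonempty) (hZne : Z.Nonempty) :
    min 1 (volume X + volume Y) + volume Z ≤
      volume ((X + Y) ∪ (({0, 1} : Set ℝ) + Z)) := by
  set S := (X + Y) ∪ (({0, 1} : Set ℝ) + Z) with hS
  let π : ℝ → UnitAddCircle := fun x => x
  let G := toMeasurable volume S
  have hG : MeasurableSet G := measurableSet_toMeasurable _ _
  have hSG : S ⊆ G := subset_toMeasurable _ _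
  let A := G ∩ Set.Ioc 0 1
  let B := (fun x : ℝ => x + 1) ⁻¹' (G ∩ Set.Ioc 1 2)
  have hA : MeasurableSet A := hG.inter measurableSet_Ioc
  have hB : MeasurableSet B := (measurable_add_const 1) (hG.inter measurableSet_Ioc)
  have hB' : B ⊆ Set.Ioc 0 1 := by
    rintro x ⟨-, hx1, hx2⟩
    constructor <;> linarith
  have hABG : volume A + volume B ≤ volume S := by
    rw [← measure_toMeasurable S, measure_preimage_add_right,
      ← measure_union _ (hG.inter measurableSet_Ioc)]
    · exact measure_mono (Set.union_subset Set.inter_subset_left Set.inter_subset_left)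
    · exact Set.disjoint_left.mpr fun x hx hx' => absurd hx'.2.1 (not_lt.mpr hx.2.2)
  have hinter : volume Z ≤ volume (A ∩ B) := by
    have hsub : Z ⊆ (A ∩ B) ∪ {0} := by
      intro z hz
      rcases (hZ hz).1.eq_or_lt with h | h
      · exact Or.inr h.symm
      · refine Or.inl ⟨⟨hSG (Or.inr ⟨0, by simp, z, hz, by simp⟩), h, (hZ hz).2⟩,
          ⟨hSG (Or.inr ⟨1, by simp, z, hz, add_comm _ _⟩), by linarith,
            by linarith [(hZ hz).2]⟩⟩
    exact (measure_mono hsub).trans ((measure_union_le _ _).trans (by simp))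
  have hunion : min 1 (volume X + volume Y) ≤ volume (A ∪ B) := by
    have hsub : π '' X + π '' Y ⊆ π '' (A ∪ B) ∪ {0} := by
      rintro _ ⟨_, ⟨x, hx, rfl⟩, _, ⟨y, hy, rfl⟩, rfl⟩
      have hmem : x + y ∈ G := hSG (Or.inl ⟨x, hx, y, hy, rfl⟩)
      have hsum : π x + π y = π (x + y) := (AddCircle.coe_add 1 x y).symm
      simp only [hsum]
      rcases (add_nonneg (hX hx).1 (hY hy).1).eq_or_lt with h | h
      · right
        simp [π, ← h]
      · left
        rcases le_or_gt (x + y) 1 with h1 | h1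
        · exact ⟨x + y, Or.inl ⟨hmem, h, h1⟩, rfl⟩
        · refine ⟨x + y - 1, Or.inr ?_, ?_⟩
          · simp only [B, Set.mem_preimage, sub_add_cancel]
            exact ⟨hmem, h1, by linarith [(hX hx).2, (hY hy).2]⟩
          · simp only [π]
            rw [AddCircle.coe_sub, AddCircle.coe_period, sub_zero]
    calc min 1 (volume X + volume Y)
        ≤ min 1 (volume (π '' X) + volume (π '' Y)) := by
          gcongr
          · exact UnitAddCircle.volume_le_volume_image_coe hX
          · exact UnitAddCircle.volume_le_volume_image_coe hY
      _ ≤ volume (π '' X + π '' Y) :=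
          UnitAddCircle.min_one_le_volume_add (hXne.image _) (hYne.image _)
      _ ≤ volume (π '' (A ∪ B)) + volume {(0 : UnitAddCircle)} :=
          (measure_mono hsub).trans (measure_union_le _ _)
      _ = volume (π '' (A ∪ B)) := by
          have h0 : volume (closedBall (0 : UnitAddCircle) 0) = 0 := by
            rw [AddCircle.volume_closedBall]; simp
          rw [← closedBall_zero, h0, add_zero]
      _ ≤ volume (A ∪ B) := UnitAddCircle.volume_image_coe_le (hA.union hB)
          (Set.union_subset Set.inter_subset_right hB')
  calc min 1 (volume X + volume Y) + volume Z
      ≤ volume (A ∪ B) + volume (A ∩ B) := add_le_add hunion hinter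
    _ = volume A + volume B := measure_union_add_inter A hB
    _ ≤ volume S := hABG
end

section
/- Let k ≥ 1 and let Y_1, …, Y_k ⊆ [0, 1] be subsets with |Y_i| ≤ 1/k for each i. Let S := ⋃_{i=1}^k ({0, 1, …, k−i} + i·Y_i), where i·Y_i denotes the i-fold Minkowski sum of Y_i with itself and {0, 1, …, k−i} is the set of integers from 0 to k−i. Then |S| ≥ Σ_{i=1}^k i·|Y_i|, where |·| denotes Lebesgue outer measure on ℝ. -/
open MeasureTheory Pointwise ENNReal

/-- The `k`-fold iterated Minkowski sumset `k·A = A + ⋯ + A` (`k` summands),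
defined for `k ≥ 1` (and as `∅` for `k = 0`). -/
def kSum {α : Type*} [Add α] : ℕ → Set α → Set α
  | 0, _ => ∅
  | 1, A => A
  | n + 2, A => kSum (n + 1) A + A

lemma kSum_subset_Icc {Y : Set ℝ} (hY : Y ⊆ Set.Icc 0 1) (n : ℕ) :
    kSum (n + 1) Y ⊆ Set.Icc 0 ((n : ℝ) + 1) := by
  induction n with
  | zero => simpa [kSum] using hY
  | succ n ih =>
    rintro _ ⟨a, ha, b, hb, rfl⟩
    have h1 := ih ha
    have h2 := hY hb
    simp only [Set.mem_Icc] at *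
    push_cast
    constructor <;> linarith

lemma isCompact_kSum {K : Set ℝ} (hK : IsCompact K) (n : ℕ) :
    IsCompact (kSum (n + 1) K) := by
  induction n with
  | zero => exact hK
  | succ n ih => exact ih.add hK

/-- The Cauchy–Davenport inequality for iterated sumsets. -/
lemma ZMod.min_le_ncard_kSum {p : ℕ} (hp : p.Prime) {A : Set (ZMod p)} (hA : A.Nonempty) (n : ℕ) :
    (kSum (n + 1) A).Nonempty ∧ min p ((n + 1) * A.ncard - n) ≤ (kSum (n + 1) A).ncard := by
  classical
  have : Fact p.Prime := ⟨hp⟩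
  induction n with
  | zero => simpa [kSum] using hA
  | succ n ih =>
    obtain ⟨hne, hle⟩ := ih
    refine ⟨hne.add hA, ?_⟩
    have hcd := ZMod.cauchy_davenport hp (s := (kSum (n + 1) A).toFinset) (t := A.toFinset)
      (by simpa using hne) (by simpa using hA)
    rw [← Set.toFinset_add, ← Set.ncard_eq_toFinset_card', ← Set.ncard_eq_toFinset_card',
      ← Set.ncard_eq_toFinset_card'] at hcd
    have hpos : 0 < A.ncard := (Set.ncard_pos).2 hA
    change min p ((n + 1 + 1) * A.ncard - (n + 1)) ≤ (kSum (n + 1) A + A).ncard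
    have : (n + 1 + 1) * A.ncard = (n + 1) * A.ncard + A.ncard := by ring
    have : n + 1 ≤ (n + 1) * A.ncard := Nat.le_mul_of_pos_right _ hpos
    omega

lemma exists_int_of_mem_kSum_floor {p : ℕ} {K : Set ℝ} (n : ℕ) {s : ZMod p}
    (hs : s ∈ kSum (n + 1) ((fun x : ℝ ↦ ((⌊(p : ℝ) * x⌋ : ℤ) : ZMod p)) '' K)) :
    ∃ x ∈ kSum (n + 1) K, ∃ m : ℤ, (m : ZMod p) = s ∧ (m : ℝ) ≤ p * x ∧ p * x < m + (n + 1) := by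
  induction n generalizing s with
  | zero =>
    obtain ⟨x, hx, rfl⟩ := hs
    exact ⟨x, hx, _, rfl, Int.floor_le _, by simp⟩
  | succ n ih =>
    obtain ⟨a, ha, _, ⟨y, hy, rfl⟩, rfl⟩ := hs
    obtain ⟨x, hx, m, rfl, h1, h2⟩ := ih ha
    refine ⟨x + y, ⟨x, hx, y, hy, rfl⟩, m + ⌊(p : ℝ) * y⌋, by push_cast; rfl, ?_, ?_⟩
    · have := Int.floor_le ((p : ℝ) * y)
      push_cast; linarith
    · have := Int.lt_floor_add_one ((p : ℝ) * y)
      push_cast; linarith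

lemma volume_Ico_div_natCast (p : ℕ) [NeZero p] (x : ℝ) :
    volume (Set.Ico (x / p) ((x + 1) / p)) = (p : ℝ≥0∞)⁻¹ := by
  have hp : (0 : ℝ) < p := by exact_mod_cast NeZero.pos p
  rw [Real.volume_Ico, ← sub_div, add_sub_cancel_left, one_div,
    ENNReal.ofReal_inv_of_pos hp, ENNReal.ofReal_natCast]

lemma volume_le_ncard_floor {p : ℕ} [NeZero p] {K : Set ℝ} (hK : K ⊆ Set.Icc 0 1) :
    volume K ≤ ((fun x : ℝ ↦ ((⌊(p : ℝ) * x⌋ : ℤ) : ZMod p)) '' K).ncard * (p : ℝ≥0∞)⁻¹ := by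
  classical
  set A := (fun x : ℝ ↦ ((⌊(p : ℝ) * x⌋ : ℤ) : ZMod p)) '' K with hA
  have hp : (0 : ℝ) < p := by exact_mod_cast NeZero.pos p
  have hsub : K \ {1} ⊆ ⋃ r ∈ A.toFinset,
      Set.Ico ((r.val : ℝ) / p) (((r.val : ℝ) + 1) / p) := by
    rintro x ⟨hx, hx1⟩
    have hx01 := hK hx
    have hlt : x < 1 := lt_of_le_of_ne hx01.2 hx1
    have h0 : 0 ≤ ⌊(p : ℝ) * x⌋ := Int.floor_nonneg.2 (mul_nonneg hp.le hx01.1)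
    have hltp : ⌊(p : ℝ) * x⌋ < p := by
      rw [Int.floor_lt]; push_cast; nlinarith
    have hval : (((⌊(p : ℝ) * x⌋ : ℤ) : ZMod p).val : ℤ) = ⌊(p : ℝ) * x⌋ := by
      rw [ZMod.val_intCast, Int.emod_eq_of_lt h0 hltp]
    have hval' : (((⌊(p : ℝ) * x⌋ : ℤ) : ZMod p).val : ℝ) = (⌊(p : ℝ) * x⌋ : ℝ) := by
      exact_mod_cast congrArg (Int.cast : ℤ → ℝ) hval
    simp only [Set.mem_iUnion, Set.mem_toFinset]
    refine ⟨_, ⟨x, hx, rfl⟩, ?_⟩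
    simp only [hval', Set.mem_Ico]
    rw [div_le_iff₀ hp, lt_div_iff₀ hp, mul_comm x]
    exact ⟨Int.floor_le _, Int.lt_floor_add_one _⟩
  calc volume K = volume (K \ {1}) := (measure_sdiff_null (by simp)).symm
    _ ≤ _ := measure_mono hsub
    _ ≤ ∑ r ∈ A.toFinset, volume (Set.Ico ((r.val : ℝ) / p) (((r.val : ℝ) + 1) / p)) :=
      measure_biUnion_finset_le _ _
    _ = A.ncard * (p : ℝ≥0∞)⁻¹ := by
      simp_rw [volume_Ico_div_natCast, Finset.sum_const, Set.ncard_eq_toFinset_card', nsmul_eq_mul]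

lemma ncard_mul_inv_le_volume {p : ℕ} [NeZero p] (B : Set (ZMod p)) {E : Set ℝ}
    (hE : ∀ r ∈ B, Set.Ico ((r.val : ℝ) / p) (((r.val : ℝ) + 1) / p) ⊆ E) :
    B.ncard * (p : ℝ≥0∞)⁻¹ ≤ volume (E ∩ Set.Ico 0 1) := by
  classical
  have hp : (0 : ℝ) < p := by exact_mod_cast NeZero.pos p
  calc B.ncard * (p : ℝ≥0∞)⁻¹
      = ∑ r ∈ B.toFinset, volume (Set.Ico ((r.val : ℝ) / p) (((r.val : ℝ) + 1) / p)) := by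
        simp_rw [volume_Ico_div_natCast, Finset.sum_const, Set.ncard_eq_toFinset_card',
          nsmul_eq_mul]
    _ = volume (⋃ r ∈ B.toFinset, Set.Ico ((r.val : ℝ) / p) (((r.val : ℝ) + 1) / p)) := by
        refine (measure_biUnion_finset ?_ fun _ _ ↦ measurableSet_Ico).symm
        intro r _ s _ hrs
        rw [Function.onFun, Set.disjoint_left]
        rintro x ⟨h1, h2⟩ ⟨h3, h4⟩
        rw [div_le_iff₀ hp] at h1 h3
        rw [lt_div_iff₀ hp] at h2 h4
        have h5 : (r.val : ℝ) < s.val + 1 := by linarith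
        have h6 : (s.val : ℝ) < r.val + 1 := by linarith
        norm_cast at h5 h6
        exact hrs (ZMod.val_injective p (by omega))
    _ ≤ volume (E ∩ Set.Ico 0 1) := by
        refine measure_mono (Set.iUnion₂_subset fun r hr ↦ Set.subset_inter
          (hE r (by simpa using hr)) ?_)
        have : (r.val : ℝ) + 1 ≤ p := by exact_mod_cast ZMod.val_lt r
        refine Set.Ico_subset_Ico (by positivity) ?_
        rwa [div_le_one hp]

/-- Raikov's inequality on the circle for iterated sumsets of a compact set. -/
lemma IsCompact.min_one_le_volume_kSum_add_int {K : Set ℝ} (hK : IsCompact K)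
    (hK01 : K ⊆ Set.Icc 0 1) (n : ℕ) :
    min 1 (((n + 1 : ℕ) : ℝ≥0∞) * volume K) ≤
      volume ((kSum (n + 1) K + Set.range ((↑) : ℤ → ℝ)) ∩ Set.Ico 0 1) := by
  rcases K.eq_empty_or_nonempty with rfl | hne
  · simp
  set C := kSum (n + 1) K + Set.range ((↑) : ℤ → ℝ) with hC
  have hCc : IsClosed C := (Int.isClosedEmbedding_coe_real.isClosed_range).add_left_of_isCompact
    (isCompact_kSum hK n)
  have key : ∀ p : ℕ, p.Prime → min 1 (((n + 1 : ℕ) : ℝ≥0∞) * volume K) ≤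
      (volume.restrict (Set.Ico 0 1)) (Metric.cthickening (((n : ℝ) + 1) / p) C) + n / p := by
    intro p hp
    have : NeZero p := ⟨hp.ne_zero⟩
    have hp0 : (0 : ℝ) < p := by exact_mod_cast hp.pos
    have hpe0 : (p : ℝ≥0∞) ≠ 0 := by exact_mod_cast hp.ne_zero
    set A := (fun x : ℝ ↦ ((⌊(p : ℝ) * x⌋ : ℤ) : ZMod p)) '' K with hA
    have h1 : volume K ≤ A.ncard * (p : ℝ≥0∞)⁻¹ := volume_le_ncard_floor hK01
    have h2 : min p ((n + 1) * A.ncard - n) ≤ (kSum (n + 1) A).ncard :=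
      (ZMod.min_le_ncard_kSum hp (hne.image _) n).2
    have h3 : (kSum (n + 1) A).ncard * (p : ℝ≥0∞)⁻¹ ≤
        (volume.restrict (Set.Ico 0 1)) (Metric.cthickening (((n : ℝ) + 1) / p) C) := by
      rw [Measure.restrict_apply Metric.isClosed_cthickening.measurableSet]
      refine ncard_mul_inv_le_volume _ fun r hr y hy ↦ ?_
      obtain ⟨x, hx, m, hm, hm1, hm2⟩ := exists_int_of_mem_kSum_floor n hr
      obtain ⟨q, hq⟩ : (p : ℤ) ∣ (r.val : ℤ) - m := by
        rw [← ZMod.intCast_zmod_eq_zero_iff_dvd]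
        simp [hm]
      have hq' : (r.val : ℝ) = m + p * q := by
        have := congrArg (Int.cast : ℤ → ℝ) hq
        push_cast at this
        linarith
      refine Metric.mem_cthickening_of_dist_le y (x + q) _ _ ⟨x, hx, q, ⟨q, rfl⟩, rfl⟩ ?_
      obtain ⟨hy1, hy2⟩ := hy
      rw [div_le_iff₀ hp0] at hy1
      rw [lt_div_iff₀ hp0] at hy2
      rw [Real.dist_eq, le_div_iff₀ hp0, ← abs_of_pos hp0, ← abs_mul, abs_le]
      have hn : (0 : ℝ) ≤ n := n.cast_nonneg
      constructor <;> nlinarith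
    refine le_trans ?_ (add_le_add_left h3 _)
    rcases le_or_gt p (kSum (n + 1) A).ncard with h | h
    · refine (min_le_left _ _).trans (le_trans ?_ le_self_add)
      calc (1 : ℝ≥0∞) = p * (p : ℝ≥0∞)⁻¹ := (ENNReal.mul_inv_cancel hpe0 (by simp)).symm
        _ ≤ _ := by gcongr
    · refine (min_le_right _ _).trans ?_
      have h4 : (n + 1) * A.ncard ≤ (kSum (n + 1) A).ncard + n := by
        omega
      calc ((n + 1 : ℕ) : ℝ≥0∞) * volume K
          ≤ ((n + 1 : ℕ) : ℝ≥0∞) * (A.ncard * (p : ℝ≥0∞)⁻¹) := by gcongr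
        _ = (((n + 1) * A.ncard : ℕ) : ℝ≥0∞) * (p : ℝ≥0∞)⁻¹ := by push_cast; ring
        _ ≤ (((kSum (n + 1) A).ncard + n : ℕ) : ℝ≥0∞) * (p : ℝ≥0∞)⁻¹ := by gcongr
        _ = _ := by push_cast; rw [add_mul, div_eq_mul_inv]
  have hr : Filter.Tendsto (fun p : ℕ ↦ ((n : ℝ) + 1) / p) Filter.atTop (nhds 0) :=
    tendsto_const_div_atTop_nhds_zero_nat _
  have : IsFiniteMeasure (volume.restrict (Set.Ico (0 : ℝ) 1)) := ⟨by simp⟩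
  have htop : Filter.Tendsto (fun p : ℕ ↦ (n : ℝ≥0∞) / p) Filter.atTop (nhds 0) := by
    simpa using ENNReal.Tendsto.const_div ENNReal.tendsto_nat_nhds_top (a := (n : ℝ≥0∞))
      (Or.inr (by simp))
  have hlim : Filter.Tendsto (fun p : ℕ ↦ (volume.restrict (Set.Ico (0 : ℝ) 1))
      (Metric.cthickening (((n : ℝ) + 1) / p) C) + (n : ℝ≥0∞) / p) Filter.atTop
      (nhds ((volume.restrict (Set.Ico 0 1)) C + 0)) :=
    ((tendsto_measure_cthickening_of_isClosed ⟨1, one_pos, MeasureTheory.measure_ne_top _ _⟩ hCc).comp hr).add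
      (htop)
  rw [add_zero, Measure.restrict_apply hCc.measurableSet] at hlim
  exact ge_of_tendsto_of_frequently hlim
    ((Nat.frequently_atTop_iff_infinite.2 Nat.infinite_setOfPred_prime).mono key)

/-- The points at which a set of reals has positive lower outer density. -/
def posDensity (T : Set ℝ) : Set ℝ :=
  {x | ∃ c : ℝ≥0∞, c ≠ 0 ∧
    ∀ᶠ r in nhdsWithin 0 (Set.Ioi 0), c * ENNReal.ofReal r ≤ volume (T ∩ Metric.closedBall x r)}

lemma posDensity_mono {S T : Set ℝ} (h : S ⊆ T) : posDensity S ⊆ posDensity T := by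
  rintro x ⟨c, hc, hx⟩
  exact ⟨c, hc, hx.mono fun r hr ↦ hr.trans (measure_mono (Set.inter_subset_inter_left _ h))⟩

lemma posDensity_subset_closure (T : Set ℝ) : posDensity T ⊆ closure T := by
  rintro x ⟨c, hc, hx⟩
  rw [Metric.mem_closure_iff]
  intro ε hε
  obtain ⟨r, hr, hr0, hrε⟩ := (hx.and (Ioo_mem_nhdsGT hε)).exists
  have hpos : 0 < volume (T ∩ Metric.closedBall x r) :=
    lt_of_lt_of_le (ENNReal.mul_pos hc (by simpa using hr0)) hr
  obtain ⟨y, hy, hyr⟩ := nonempty_of_measure_ne_zero hpos.ne'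
  exact ⟨y, hy, by rw [dist_comm]; exact lt_of_le_of_lt hyr hrε⟩

lemma add_mem_posDensity {S T : Set ℝ} {x y : ℝ} (hx : x ∈ posDensity S) (hy : y ∈ closure T) :
    x + y ∈ posDensity (S + T) := by
  obtain ⟨c, hc, hx⟩ := hx
  refine ⟨c * ENNReal.ofReal (1 / 2), mul_ne_zero hc (by simp), ?_⟩
  have hhalf : Filter.Tendsto (fun r : ℝ ↦ 1 / 2 * r) (nhdsWithin 0 (Set.Ioi 0))
      (nhdsWithin 0 (Set.Ioi 0)) := by
    refine tendsto_nhdsWithin_iff.2 ⟨?_, ?_⟩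
    · have : Filter.Tendsto (fun r : ℝ ↦ 1 / 2 * r) (nhds 0) (nhds (1 / 2 * 0)) :=
        (continuous_const.mul continuous_id).tendsto 0
      rw [mul_zero] at this
      exact this.mono_left nhdsWithin_le_nhds
    · filter_upwards [self_mem_nhdsWithin] with r hr
      simpa using hr
  filter_upwards [hhalf.eventually hx, self_mem_nhdsWithin] with r hr hr0
  rw [mul_assoc, ← ENNReal.ofReal_mul (by norm_num)]
  refine hr.trans ?_
  obtain ⟨z, hz, hyz⟩ := Metric.mem_closure_iff.1 hy (1 / 2 * r) (by simpa using hr0)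
  rw [← measure_preimage_add_right volume z ((S + T) ∩ Metric.closedBall (x + y) r)]
  refine measure_mono fun s hs ↦ ⟨⟨s, hs.1, z, hz, rfl⟩, ?_⟩
  have h1 : dist s x ≤ 1 / 2 * r := hs.2
  rw [dist_comm] at hyz
  rw [Metric.mem_closedBall]
  linarith [dist_add_add_le s z x y]

lemma kSum_subset_posDensity {K Y : Set ℝ} (hK : K ⊆ posDensity Y) (n : ℕ) :
    kSum (n + 1) K ⊆ posDensity (kSum (n + 1) Y) := by
  induction n with
  | zero => exact hK
  | succ n ih =>
    rintro _ ⟨a, ha, b, hb, rfl⟩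
    exact add_mem_posDensity (ih ha) (posDensity_subset_closure _ (hK hb))

lemma ae_mem_posDensity {T : Set ℝ} (hT : MeasurableSet T) :
    ∀ᵐ x, x ∈ T → x ∈ posDensity T := by
  filter_upwards [Besicovitch.ae_tendsto_measure_inter_div_of_measurableSet volume hT]
    with x hx hxT
  rw [Set.indicator_of_mem hxT] at hx
  refine ⟨1, one_ne_zero, ?_⟩
  have h : (2 : ℝ≥0∞)⁻¹ < (1 : ℝ → ℝ≥0∞) x := by simp
  filter_upwards [hx.eventually (lt_mem_nhds h), self_mem_nhdsWithin] with r hr hr0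
  have hr0' : (0 : ℝ) < r := hr0
  rw [Real.volume_closedBall, ENNReal.lt_div_iff_mul_lt (by simp [hr0']) (by simp),
    ENNReal.ofReal_mul (by norm_num), ENNReal.ofReal_ofNat, ← mul_assoc,
    ENNReal.inv_mul_cancel (by simp) (by simp)] at hr
  exact hr.le

lemma ae_mem_of_mem_posDensity {T : Set ℝ} (hT : MeasurableSet T) :
    ∀ᵐ x, x ∈ posDensity T → x ∈ T := by
  filter_upwards [Besicovitch.ae_tendsto_measure_inter_div_of_measurableSet volume hT]
    with x hx
  rintro ⟨c, hc, hxc⟩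
  by_contra hxT
  rw [Set.indicator_of_notMem hxT] at hx
  refine (ENNReal.div_pos hc (by simp : (2 : ℝ≥0∞) ≠ ∞)).not_ge (ge_of_tendsto hx ?_)
  filter_upwards [hxc, self_mem_nhdsWithin] with r hr hr0
  have hr0' : (0 : ℝ) < r := hr0
  rw [Real.volume_closedBall, ENNReal.le_div_iff_mul_le (Or.inl (by simp [hr0']))
      (Or.inl (ENNReal.ofReal_ne_top)),
    ENNReal.ofReal_mul (by norm_num), ENNReal.ofReal_ofNat, ← mul_assoc,
    ENNReal.div_mul_cancel (by simp) (by simp)]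
  exact hr

lemma volume_posDensity_inter_le (T : Set ℝ) {s : Set ℝ} (hs : MeasurableSet s) :
    volume (posDensity T ∩ s) ≤ volume (T ∩ s) := by
  rw [← Measure.measure_toMeasurable_inter_of_sFinite hs T]
  refine measure_mono_ae ?_
  filter_upwards [ae_mem_of_mem_posDensity (measurableSet_toMeasurable volume T)] with x hx hxs
  exact ⟨hx (posDensity_mono (subset_toMeasurable _ _) hxs.1), hxs.2⟩

/-- Raikov's inequality on the circle for iterated sumsets, for outer measure. -/
lemma min_one_le_volume_kSum_add_int {Y : Set ℝ} (hY : Y ⊆ Set.Icc 0 1) (n : ℕ) :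
    min 1 (((n + 1 : ℕ) : ℝ≥0∞) * volume Y) ≤
      volume ((kSum (n + 1) Y + Set.range ((↑) : ℤ → ℝ)) ∩ Set.Ico 0 1) := by
  set R := volume ((kSum (n + 1) Y + Set.range ((↑) : ℤ → ℝ)) ∩ Set.Ico 0 1) with hR
  have hn0 : ((n + 1 : ℕ) : ℝ≥0∞) ≠ 0 := by simp
  have hYtop : volume Y ≠ ∞ := ne_top_of_le_ne_top (by simp) (measure_mono hY)
  by_contra! hlt
  obtain ⟨hR1, hRY⟩ := lt_min_iff.1 hlt
  set Y' := toMeasurable volume Y ∩ Set.Icc 0 1 with hY'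
  have hY'm : MeasurableSet Y' := (measurableSet_toMeasurable _ _).inter measurableSet_Icc
  set N := toMeasurable volume {x | ¬ (x ∈ Y' → x ∈ posDensity Y')} with hN
  have hN0 : volume N = 0 := by
    rw [hN, measure_toMeasurable]; exact ae_iff.1 (ae_mem_posDensity hY'm)
  have hYN : volume Y ≤ volume (Y' \ N) := by
    rw [measure_sdiff_null hN0]
    exact measure_mono (Set.subset_inter (subset_toMeasurable _ _) hY)
  have hlt' : R / (n + 1 : ℕ) < volume (Y' \ N) := by
    refine lt_of_lt_of_le ?_ hYN
    rw [ENNReal.div_lt_iff (Or.inl hn0) (Or.inl (by simp)), mul_comm]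
    exact hRY
  obtain ⟨K, hKsub, hK, hKR⟩ :=
    (hY'm.diff (measurableSet_toMeasurable _ _)).exists_lt_isCompact hlt'
  rw [ENNReal.div_lt_iff (Or.inl hn0) (Or.inl (by simp)), mul_comm] at hKR
  have hKd : K ⊆ posDensity Y := by
    intro x hx
    obtain ⟨hxY, hxN⟩ := hKsub hx
    have hxd : x ∈ posDensity Y' := by
      by_contra h
      exact hxN (subset_toMeasurable _ _ fun h' ↦ h (h' hxY))
    obtain ⟨c, hc, hcx⟩ := posDensity_mono Set.inter_subset_left hxd
    refine ⟨c, hc, hcx.mono fun r hr ↦ hr.trans ?_⟩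
    rw [Measure.measure_toMeasurable_inter Metric.isClosed_closedBall.measurableSet hYtop]
  have hK01 : K ⊆ Set.Icc 0 1 := fun x hx ↦ (hKsub hx).1.2
  refine (lt_min hR1 hKR).not_ge ((hK.min_one_le_volume_kSum_add_int hK01 n).trans ?_)
  refine le_trans (measure_mono (Set.inter_subset_inter_left _ ?_))
    (volume_posDensity_inter_le _ measurableSet_Ico)
  rintro _ ⟨a, ha, b, hb, rfl⟩
  exact add_mem_posDensity (kSum_subset_posDensity hKd n ha) (subset_closure hb)

/-- A layer-cake bound: if the points of `Q j` lie in at least `k + 1 - j` of the sets `E m`, then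
the measures of the `Q j` sum to at most the sum of those of the `E m`. -/
lemma sum_measure_le_sum_measure_of_le_card {α ι : Type*} [MeasurableSpace α] (μ : Measure α)
    (F : Finset ι) (E : ι → Set α) (hE : ∀ m ∈ F, MeasurableSet (E m)) (k : ℕ) (Q : ℕ → Set α)
    (hQ : ∀ j ∈ Finset.Icc 1 k, ∀ x ∈ Q j, ∃ G ⊆ F, (∀ m ∈ G, x ∈ E m) ∧ k + 1 - j ≤ G.card) :
    ∑ j ∈ Finset.Icc 1 k, μ (Q j) ≤ ∑ m ∈ F, μ (E m) := by
  classical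
  set N : α → ℕ := fun x ↦ ∑ m ∈ F, (E m).indicator 1 x with hN
  have hNm : Measurable N :=
    Finset.measurable_fun_sum F fun m hm ↦ measurable_const.indicator (hE m hm)
  have hlev : ∀ j, MeasurableSet {x | k + 1 - j ≤ N x} := fun j ↦
    measurableSet_le measurable_const hNm
  calc ∑ j ∈ Finset.Icc 1 k, μ (Q j)
      ≤ ∑ j ∈ Finset.Icc 1 k, μ {x | k + 1 - j ≤ N x} := by
        refine Finset.sum_le_sum fun j hj ↦ measure_mono fun x hx ↦ ?_
        obtain ⟨G, hGF, hG, hcard⟩ := hQ j hj x hx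
        refine hcard.trans ?_
        calc G.card = ∑ m ∈ G, (E m).indicator (1 : α → ℕ) x := by
              rw [Finset.card_eq_sum_ones]
              exact Finset.sum_congr rfl fun m hm ↦ by simp [hG m hm]
          _ ≤ N x := Finset.sum_le_sum_of_subset hGF
    _ = ∫⁻ x, ∑ j ∈ Finset.Icc 1 k, {x | k + 1 - j ≤ N x}.indicator 1 x ∂μ := by
        rw [lintegral_finsetSum _ fun j _ ↦ measurable_one.indicator (hlev j)]
        exact Finset.sum_congr rfl fun j _ ↦ (lintegral_indicator_one (hlev j)).symm
    _ ≤ ∫⁻ x, ∑ m ∈ F, (E m).indicator 1 x ∂μ := by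
        refine lintegral_mono fun x ↦ ?_
        have h1 : ∑ m ∈ F, (E m).indicator (1 : α → ℝ≥0∞) x = (N x : ℝ≥0∞) := by
          simp [hN, Set.indicator_apply]
        have h2 : ∑ j ∈ Finset.Icc 1 k, {x | k + 1 - j ≤ N x}.indicator (1 : α → ℝ≥0∞) x =
            (((Finset.Icc 1 k).filter fun j ↦ k + 1 - j ≤ N x).card : ℝ≥0∞) := by
          simp [Set.indicator_apply]
        simp only [h1, h2]
        norm_cast
        calc _ ≤ (Finset.Icc (k + 1 - N x) k).card := by
              refine Finset.card_le_card fun j hj ↦ ?_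
              simp only [Finset.mem_filter, Finset.mem_Icc] at hj ⊢
              omega
          _ ≤ N x := by simp; omega
    _ = ∑ m ∈ F, μ (E m) := by
        rw [lintegral_finsetSum' _ fun m hm ↦ (measurable_one.indicator (hE m hm)).aemeasurable]
        exact Finset.sum_congr rfl fun m hm ↦ lintegral_indicator_one (hE m hm)

lemma sum_volume_translates_le {S : Set ℝ} (hS : MeasurableSet S) (k : ℕ) :
    ∑ m ∈ Finset.range k, volume (Set.Ico (0 : ℝ) 1 ∩ (· + (m : ℝ)) ⁻¹' S) ≤ volume S := by
  have h : ∀ m : ℕ, volume (Set.Ico (0 : ℝ) 1 ∩ (· + (m : ℝ)) ⁻¹' S) =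
      volume (S ∩ Set.Ico (m : ℝ) (m + 1)) := fun m ↦ by
    rw [← measure_preimage_add_right volume (m : ℝ) (S ∩ Set.Ico (m : ℝ) (m + 1))]
    congr 1
    ext x
    simp only [Set.mem_preimage, Set.mem_inter_iff, Set.mem_Ico]
    constructor
    · rintro ⟨⟨h1, h2⟩, h3⟩
      exact ⟨h3, by linarith, by linarith⟩
    · rintro ⟨h3, h1, h2⟩
      exact ⟨⟨by linarith, by linarith⟩, h3⟩
  simp_rw [h]
  rw [← measure_biUnion_finset _ fun m _ ↦ hS.inter measurableSet_Ico]
  · exact measure_mono (Set.iUnion₂_subset fun m _ ↦ Set.inter_subset_left)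
  · intro a _ b _ hab
    rw [Function.onFun, Set.disjoint_left]
    rintro x ⟨_, h1, h2⟩ ⟨_, h3, h4⟩
    have h5 : (a : ℝ) < b + 1 := by linarith
    have h6 : (b : ℝ) < a + 1 := by linarith
    norm_cast at h5 h6
    omega

/-- **Key one-dimensional lemma for iterated sumsets.**
Let `Y_1, …, Y_k ⊆ [0,1]` with `|Y_i| ≤ 1/k`, and let
`S := ⋃_{i=1}^k ({0, 1, …, k-i} + i·Y_i)`. Then `|S| ≥ ∑_{i=1}^k i |Y_i|`. -/
theorem iterated_one_dim_lemma (k : ℕ) (hk : 1 ≤ k) (Y : ℕ → Set ℝ)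
    (hY : ∀ i ∈ Finset.Icc 1 k, Y i ⊆ Set.Icc 0 1)
    (hYm : ∀ i ∈ Finset.Icc 1 k, volume (Y i) ≤ 1 / (k : ℝ≥0∞)) :
    ∑ i ∈ Finset.Icc 1 k, (i : ℝ≥0∞) * volume (Y i) ≤
      volume (⋃ i ∈ Finset.Icc 1 k,
        (((↑) : ℕ → ℝ) '' {j : ℕ | j ≤ k - i} + kSum i (Y i))) := by
  classical
  set S := ⋃ i ∈ Finset.Icc 1 k, (((↑) : ℕ → ℝ) '' {j : ℕ | j ≤ k - i} + kSum i (Y i)) with hS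
  have hk0 : (k : ℝ≥0∞) ≠ 0 := by
    simp only [ne_eq, Nat.cast_eq_zero]; omega
  set S' := toMeasurable volume S with hS'
  have hS'm : MeasurableSet S' := measurableSet_toMeasurable _ _
  calc ∑ i ∈ Finset.Icc 1 k, (i : ℝ≥0∞) * volume (Y i)
      ≤ ∑ i ∈ Finset.Icc 1 k,
          volume ((kSum i (Y i) + Set.range ((↑) : ℤ → ℝ)) ∩ Set.Ico 0 1) := by
        refine Finset.sum_le_sum fun i hi ↦ ?_
        have h1 : (i : ℝ≥0∞) * volume (Y i) ≤ 1 := by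
          calc (i : ℝ≥0∞) * volume (Y i) ≤ k * (1 / k) := by
                gcongr
                · exact (Finset.mem_Icc.1 hi).2
                · exact hYm i hi
            _ = 1 := ENNReal.mul_div_cancel hk0 (by simp)
        obtain ⟨n, rfl⟩ : ∃ n, i = n + 1 := ⟨i - 1, by have := (Finset.mem_Icc.1 hi).1; omega⟩
        simpa only [min_eq_right h1] using min_one_le_volume_kSum_add_int (hY _ hi) n
    _ ≤ ∑ m ∈ Finset.range (k + 1), volume (Set.Ico (0 : ℝ) 1 ∩ (· + (m : ℝ)) ⁻¹' S') := by
        refine sum_measure_le_sum_measure_of_le_card volume (Finset.range (k + 1))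
          (fun m ↦ Set.Ico (0 : ℝ) 1 ∩ (· + (m : ℝ)) ⁻¹' S')
          (fun m _ ↦ measurableSet_Ico.inter (measurable_add_const (m : ℝ) hS'm)) k
          (fun i ↦ (kSum i (Y i) + Set.range ((↑) : ℤ → ℝ)) ∩ Set.Ico 0 1) ?_
        rintro i hi x ⟨⟨y, hy, _, ⟨q, rfl⟩, hyq⟩, hx⟩
        simp only at hyq
        have hi' := Finset.mem_Icc.1 hi
        have hy0 : y ∈ Set.Icc (0 : ℝ) i := by
          obtain ⟨n, rfl⟩ : ∃ n, i = n + 1 := ⟨i - 1, by omega⟩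
          exact_mod_cast kSum_subset_Icc (hY _ hi) n hy
        have hq1 : (-1 : ℝ) < -q := by linarith [hx.2, hy0.1]
        have hq2 : (-q : ℝ) ≤ i := by linarith [hx.1, hy0.2]
        norm_cast at hq1 hq2
        obtain ⟨t, ht⟩ : ∃ t : ℕ, -q = t := Int.eq_ofNat_of_zero_le (by omega)
        have htq : (q : ℝ) = -t := by
          have : q = -(t : ℤ) := by omega
          rw [this]; push_cast; rfl
        refine ⟨(Finset.range (k + 1 - i)).image (t + ·), ?_, ?_, ?_⟩
        · intro m hm
          obtain ⟨l, hl, rfl⟩ := Finset.mem_image.1 hm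
          rw [Finset.mem_range] at hl ⊢
          omega
        · intro m hm
          obtain ⟨l, hl, rfl⟩ := Finset.mem_image.1 hm
          rw [Finset.mem_range] at hl
          refine ⟨hx, subset_toMeasurable _ _ (Set.mem_biUnion hi ?_)⟩
          refine ⟨l, ⟨l, by simp only [Set.mem_ofPred_eq]; omega, rfl⟩, y, hy, ?_⟩
          push_cast
          linarith
        · rw [Finset.card_image_of_injective _ (add_right_injective t), Finset.card_range]
    _ ≤ volume S' := sum_volume_translates_le hS'm _
    _ = volume S := measure_toMeasurable S
end

section
/- Let k ≥ 1 and let A ⊆ ℝ be a nonempty bounded measurable set of positive measure. Let ℓ := min{⌊|co(A)|/|A|⌋, k}. Then |k·A| ≥ (ℓ(ℓ+1)/2)·|A| + (k − ℓ)·|co(A)|. -/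
open MeasureTheory Pointwise ENNReal

/-- The number of elements of `X` in the residue class `z` modulo `p`. -/
def residueCount (p : ℕ) (X : Finset ℤ) (z : ZMod p) : ℕ :=
  (X.filter fun x : ℤ => (x : ZMod p) = z).card

theorem sum_residueCount (p : ℕ) [NeZero p] (X : Finset ℤ) :
    ∑ z : ZMod p, residueCount p X z = X.card :=
  (Finset.card_eq_sum_card_fiberwise fun _ _ => Finset.mem_coe.2 (Finset.mem_univ _)).symm

theorem residueCount_le_residueCount_add (p : ℕ) (X A : Finset ℤ) {a : ℤ} (ha : a ∈ A)
    (z : ZMod p) : residueCount p X z ≤ residueCount p (X + A) (z + a) := by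
  refine Finset.card_le_card_of_injOn (fun x => x + a) ?_ (fun x _ y _ h => add_right_cancel h)
  intro x hx
  simp only [Finset.coe_filter, Set.mem_ofPred_eq] at hx ⊢
  exact ⟨Finset.add_mem_add hx.1 ha, by push_cast; rw [hx.2]⟩

theorem residueCount_lt_residueCount_add (p : ℕ) [NeZero p] (X A : Finset ℤ) (h0 : 0 ∈ A)
    (hp : (p : ℤ) ∈ A) (z : ZMod p) (hz : 0 < residueCount p X z) :
    residueCount p X z < residueCount p (X + A) z := by
  apply Finset.card_lt_card
  rw [Finset.ssubset_iff_of_subset]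
  · have hne := Finset.card_pos.1 hz
    have hm := Finset.max'_mem _ hne
    refine ⟨Finset.max' _ hne + p, ?_, fun h => ?_⟩
    · rw [Finset.mem_filter] at hm ⊢
      exact ⟨Finset.add_mem_add hm.1 hp, by push_cast; simp [hm.2]⟩
    · have := Finset.le_max' _ _ h
      have := NeZero.pos p
      omega
  · intro x hx
    rw [Finset.mem_filter] at hx ⊢
    exact ⟨by simpa using Finset.add_mem_add hx.1 h0, hx.2⟩

theorem sum_min_eq_sum_card_lt {ι : Type*} [Fintype ι] (r : ι → ℕ) (h : ℕ) :
    ∑ z, min (r z) h = ∑ j ∈ Finset.range h, (Finset.univ.filter fun z => j < r z).card := by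
  simp_rw [Finset.card_filter]
  rw [Finset.sum_comm]
  refine Finset.sum_congr rfl fun z _ => ?_
  rw [← Finset.card_filter]
  have : (Finset.range h).filter (fun j => j < r z) = Finset.range (min (r z) h) := by
    ext j; simp; tauto
  rw [this, Finset.card_range]

theorem card_le_card_image_intCast_add_one {p : ℕ} {A : Finset ℤ}
    (hA : A ⊆ Finset.Icc 0 (p : ℤ)) :
    A.card ≤ (A.image fun x : ℤ => (x : ZMod p)).card + 1 := by
  have hinj : Set.InjOn (fun x : ℤ => (x : ZMod p)) (A.erase (p : ℤ)) := by
    intro x hx y hy hxy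
    simp only [Finset.coe_erase, Set.mem_sdiff, Finset.mem_coe, Set.mem_singleton_iff] at hx hy
    have hx' := Finset.mem_Icc.1 (hA hx.1)
    have hy' := Finset.mem_Icc.1 (hA hy.1)
    have h := (ZMod.intCast_eq_intCast_iff x y p).1 hxy
    rw [Int.ModEq, Int.emod_eq_of_lt hx'.1 (by omega), Int.emod_eq_of_lt hy'.1 (by omega)] at h
    exact h
  calc A.card ≤ (A.erase (p : ℤ)).card + 1 := by have := A.pred_card_le_card_erase (a := (p : ℤ)); omega
    _ = ((A.erase (p : ℤ)).image fun x : ℤ => (x : ZMod p)).card + 1 := by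
      rw [Finset.card_image_of_injOn hinj]
    _ ≤ _ := by gcongr; exact Finset.erase_subset _ _

theorem le_residueCount_zero {p : ℕ} [NeZero p] {X : Finset ℤ} {h : ℕ}
    (hX : ∀ i < h, (i * p : ℤ) ∈ X) : h ≤ residueCount p X 0 := by
  conv_lhs => rw [← Finset.card_range h]
  refine Finset.card_le_card_of_injOn (fun i : ℕ => (i * p : ℤ)) ?_ ?_
  · intro i hi
    simp only [Finset.coe_filter, Set.mem_ofPred_eq]
    exact ⟨hX i (by simpa using hi), by simp⟩
  · intro i _ j _ hij
    have := NeZero.ne p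
    simpa [this] using hij

/-- A set of integers containing `0, p, …, (h - 1) p` grows by at least
`min p (h (|A| - 2))` when a set `A ⊆ [0, p]` containing both `0` and `p` is added to it. -/
theorem card_add_min_le_card_add {p : ℕ} (hp : p.Prime) {X A : Finset ℤ} {h : ℕ}
    (hA : A ⊆ Finset.Icc 0 (p : ℤ)) (h0 : 0 ∈ A) (hpA : (p : ℤ) ∈ A)
    (hX : ∀ i < h, (i * p : ℤ) ∈ X) :
    X.card + min p (h * (A.card - 2)) ≤ (X + A).card := by
  have : NeZero p := ⟨hp.ne_zero⟩
  set B : Finset (ZMod p) := A.image fun x : ℤ => (x : ZMod p)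
  have hBA : A.card ≤ B.card + 1 := card_le_card_image_intCast_add_one hA
  have hBne : B.Nonempty := ⟨_, Finset.mem_image_of_mem _ h0⟩
  let L : ℕ → Finset (ZMod p) := fun j => Finset.univ.filter fun z => j < residueCount p X z
  have hadd : ∀ j, L j + B ⊆ Finset.univ.filter fun z => j < residueCount p (X + A) z := by
    intro j z hz
    obtain ⟨x, hx, b, hb, rfl⟩ := Finset.mem_add.1 hz
    obtain ⟨a, ha, rfl⟩ := Finset.mem_image.1 hb
    simp only [L, Finset.mem_filter, Finset.mem_univ, true_and] at hx ⊢
    exact hx.trans_le (residueCount_le_residueCount_add p X A ha x)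
  have hle : ∀ z, residueCount p X z ≤ residueCount p (X + A) z := fun z => by
    simpa using residueCount_le_residueCount_add p X A h0 z
  rw [← sum_residueCount p X, ← sum_residueCount p (X + A)]
  by_cases hfull : L 0 + B = Finset.univ
  · refine le_trans (add_le_add_right (min_le_left _ _) _) ?_
    calc _ = ∑ z : ZMod p, (residueCount p X z + 1) := by
          simp [Finset.sum_add_distrib, ZMod.card]
      _ ≤ _ := by
        refine Finset.sum_le_sum fun z _ => ?_
        rcases Nat.eq_zero_or_pos (residueCount p X z) with hz | hz
        · have : z ∈ L 0 + B := hfull ▸ Finset.mem_univ z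
          have := (Finset.mem_filter.1 (hadd 0 this)).2
          omega
        · exact residueCount_lt_residueCount_add p X A h0 hpA z hz
  · have hlt : (L 0 + B).card < p := by
      have := Finset.card_lt_univ_of_notMem (s := L 0 + B)
        (x := (not_forall.1 (mt Finset.eq_univ_iff_forall.2 hfull)).choose)
        (not_forall.1 (mt Finset.eq_univ_iff_forall.2 hfull)).choose_spec
      rwa [ZMod.card] at this
    have hlayer : ∀ j ∈ Finset.range h, (L j).card + (A.card - 2) ≤
        (Finset.univ.filter fun z => j < residueCount p (X + A) z).card := by
      intro j hj
      have hne : (L j).Nonempty :=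
        ⟨0, Finset.mem_filter.2 ⟨Finset.mem_univ _,
          (Finset.mem_range.1 hj).trans_le (le_residueCount_zero hX)⟩⟩
      have hsub : L j ⊆ L 0 := by
        intro z hz
        simp only [L, Finset.mem_filter, Finset.mem_univ, true_and] at hz ⊢
        omega
      have h1 := ZMod.cauchy_davenport hp hne hBne
      have h2 : (L j + B).card ≤ (L 0 + B).card :=
        Finset.card_le_card (Finset.add_subset_add_right hsub)
      have h3 := Finset.card_le_card (hadd j)
      have := hBne.card_pos
      omega
    have hsum := Finset.sum_le_sum hlayer
    rw [Finset.sum_add_distrib, ← sum_min_eq_sum_card_lt, ← sum_min_eq_sum_card_lt,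
      Finset.sum_const, Finset.card_range, smul_eq_mul] at hsum
    have hrest : ∑ z : ZMod p, (residueCount p X z + min (residueCount p (X + A) z) h) ≤
        ∑ z : ZMod p, (residueCount p (X + A) z + min (residueCount p X z) h) :=
      Finset.sum_le_sum fun z _ => by have := hle z; omega
    rw [Finset.sum_add_distrib, Finset.sum_add_distrib] at hrest
    have := min_le_right p (h * (A.card - 2))
    omega

theorem mul_mem_nsmul_of_le {p : ℕ} {A : Finset ℤ} (h0 : 0 ∈ A) (hpA : (p : ℤ) ∈ A) (n : ℕ) :
    ∀ i < n + 1, (i * p : ℤ) ∈ n • A := by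
  induction n with
  | zero => intro i hi; obtain rfl : i = 0 := by omega
            simp
  | succ n ih =>
    intro i hi
    rw [succ_nsmul]
    rcases Nat.lt_or_ge i (n + 1) with h | h
    · simpa using Finset.add_mem_add (ih i h) h0
    · obtain rfl : i = n + 1 := by omega
      have := Finset.add_mem_add (ih n (by omega)) hpA
      push_cast
      rwa [add_one_mul]

/-- A discrete form of Lev's theorem on iterated sumsets, for sets of prime diameter. -/
theorem sum_min_le_card_nsmul {p : ℕ} (hp : p.Prime) {A : Finset ℤ}
    (hA : A ⊆ Finset.Icc 0 (p : ℤ)) (h0 : 0 ∈ A) (hpA : (p : ℤ) ∈ A) (n : ℕ) :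
    ∑ j ∈ Finset.range n, min p ((j + 1) * (A.card - 2)) ≤ (n • A).card := by
  induction n with
  | zero => simp
  | succ n ih =>
    rw [Finset.sum_range_succ, succ_nsmul]
    exact (Nat.add_le_add_right ih _).trans
      (card_add_min_le_card_add hp hA h0 hpA (mul_mem_nsmul_of_le h0 hpA n))

theorem kSum_eq_nsmul {α : Type*} [AddMonoid α] (A : Set α) {n : ℕ} (hn : 1 ≤ n) :
    kSum n A = n • A := by
  induction n, hn using Nat.le_induction with
  | base => simp [kSum]
  | succ n hn ih =>
    obtain ⟨m, rfl⟩ := Nat.exists_eq_add_of_le' hn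
    rw [succ_nsmul, ← ih, kSum]

theorem volume_biUnion_Ico_int (c : ℝ) {δ : ℝ} (hδ : 0 < δ) (s : Finset ℤ) :
    volume (⋃ n ∈ s, Set.Ico (c + n * δ) (c + (n + 1) * δ)) = ENNReal.ofReal (s.card * δ) := by
  rw [measure_biUnion_finset]
  · have : ∀ n : ℤ, volume (Set.Ico (c + n * δ) (c + (n + 1) * δ)) = ENNReal.ofReal δ := fun n => by
      rw [Real.volume_Ico]; ring_nf
    simp [this, ENNReal.ofReal_mul]
  · intro m _ n _ hmn
    refine Set.disjoint_left.2 fun x hx hy => hmn ?_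
    have h1 : (m : ℝ) * δ < (n + 1) * δ := by linarith [hx.1, hy.2]
    have h2 : (n : ℝ) * δ < (m + 1) * δ := by linarith [hy.1, hx.2]
    have h3 : m < n + 1 := by exact_mod_cast lt_of_mul_lt_mul_right h1 hδ.le
    have h4 : n < m + 1 := by exact_mod_cast lt_of_mul_lt_mul_right h2 hδ.le
    omega
  · exact fun _ _ => measurableSet_Ico

theorem exists_mem_nsmul_near {K : Set ℝ} {F : Finset ℤ} {α δ : ℝ}
    (hF : ∀ n ∈ F, ∃ x ∈ K, α + n * δ ≤ x ∧ x ≤ α + n * δ + δ) (k : ℕ) :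
    ∀ n ∈ k • F, ∃ x ∈ k • K, k * α + n * δ ≤ x ∧ x ≤ k * α + n * δ + k * δ := by
  induction k with
  | zero => simp
  | succ k ih =>
    intro n hn
    rw [succ_nsmul] at hn
    obtain ⟨a, ha, b, hb, rfl⟩ := Finset.mem_add.1 hn
    obtain ⟨x, hx, hx1, hx2⟩ := ih a ha
    obtain ⟨y, hy, hy1, hy2⟩ := hF b hb
    refine ⟨x + y, succ_nsmul K k ▸ Set.add_mem_add hx hy, ?_, ?_⟩ <;> push_cast <;> linarith

theorem sum_min_le_volume_cthickening_nsmul {K : Set ℝ} {α β : ℝ} (hα : α ∈ K) (hβ : β ∈ K)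
    (hαβ : α < β) (hK : K ⊆ Set.Icc α β) (k : ℕ) {p : ℕ} (hp : p.Prime) :
    ENNReal.ofReal (∑ j ∈ Finset.range k,
      min (β - α) ((j + 1) * ((volume K).toReal - 2 * ((β - α) / p)))) ≤
      volume (Metric.cthickening ((k + 1) * ((β - α) / p)) (k • K)) := by
  classical
  have hp0 : (0 : ℝ) < p := by exact_mod_cast hp.pos
  set δ : ℝ := (β - α) / p with hδdef
  have hδ : 0 < δ := div_pos (sub_pos.2 hαβ) hp0
  have hpδ : p * δ = β - α := by rw [hδdef]; field_simp
  set F : Finset ℤ := (Finset.Icc 0 (p : ℤ)).filter fun n => ∃ x ∈ K, ⌊(x - α) / δ⌋ = n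
  have hmem : ∀ x ∈ K, ⌊(x - α) / δ⌋ ∈ F := by
    intro x hx
    have hx' := hK hx
    refine Finset.mem_filter.2 ⟨Finset.mem_Icc.2 ⟨?_, ?_⟩, x, hx, rfl⟩
    · exact Int.floor_nonneg.2 (div_nonneg (sub_nonneg.2 hx'.1) hδ.le)
    · have : (x - α) / δ ≤ p := by rw [div_le_iff₀ hδ]; linarith [hx'.2]
      have := (Int.floor_le ((x - α) / δ)).trans this
      exact_mod_cast this
  have h0F : 0 ∈ F := by simpa using hmem α hα
  have hpF : (p : ℤ) ∈ F := by
    have := hmem β hβ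
    rwa [← hpδ, mul_div_cancel_right₀ _ hδ.ne', Int.floor_natCast] at this
  have hcell : ∀ x : ℝ, α + ⌊(x - α) / δ⌋ * δ ≤ x ∧ x < α + (⌊(x - α) / δ⌋ + 1) * δ := by
    intro x
    have h1 := Int.floor_le ((x - α) / δ)
    have h2 := Int.lt_floor_add_one ((x - α) / δ)
    rw [le_div_iff₀ hδ] at h1
    rw [div_lt_iff₀ hδ] at h2
    constructor <;> linarith
  have hvolK : (volume K).toReal ≤ F.card * δ := by
    refine ENNReal.toReal_le_of_le_ofReal (by positivity) ?_
    rw [← volume_biUnion_Ico_int α hδ F]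
    exact measure_mono fun x hx => Set.mem_biUnion (hmem x hx) (hcell x)
  have hvol : ENNReal.ofReal ((k • F).card * δ) ≤
      volume (Metric.cthickening ((k + 1) * δ) (k • K)) := by
    rw [← volume_biUnion_Ico_int (k * α) hδ]
    refine measure_mono (Set.iUnion₂_subset fun n hn y hy => ?_)
    obtain ⟨x, hx, hx1, hx2⟩ := exists_mem_nsmul_near (K := K) (F := F) (α := α) (δ := δ)
      (fun n hn => by
        obtain ⟨x, hx, rfl⟩ := (Finset.mem_filter.1 hn).2
        have := hcell x
        exact ⟨x, hx, this.1, by linarith⟩) k n hn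
    refine Metric.mem_cthickening_of_dist_le y x _ _ hx ?_
    have hk : 0 ≤ k * δ := by positivity
    rw [Real.dist_eq, abs_le]
    constructor <;> linarith [hy.1, hy.2]
  refine le_trans (ENNReal.ofReal_le_ofReal ?_) hvol
  have hdisc := sum_min_le_card_nsmul hp (Finset.filter_subset _ _) h0F hpF k
  have hdisc' : ((∑ j ∈ Finset.range k, min p ((j + 1) * (F.card - 2)) : ℕ) : ℝ) * δ ≤
      (k • F).card * δ := by gcongr
  refine le_trans ?_ hdisc'
  push_cast
  rw [Finset.sum_mul]
  refine Finset.sum_le_sum fun j _ => ?_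
  rw [min_mul_of_nonneg _ _ hδ.le, hpδ, mul_assoc]
  have hsub : (F.card : ℝ) - 2 ≤ ((F.card - 2 : ℕ) : ℝ) := by
    rw [sub_le_iff_le_add]
    exact_mod_cast (show F.card ≤ F.card - 2 + 2 by omega)
  gcongr
  nlinarith

theorem IsCompact.nsmul_set {K : Set ℝ} (hK : IsCompact K) (k : ℕ) : IsCompact (k • K) := by
  induction k with
  | zero => simp
  | succ k ih => rw [succ_nsmul]; exact ih.add hK

/-- The bound `|k • K| ≥ ∑_{j=1}^k min(diam K, j |K|)` for compact sets of reals. -/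
theorem sum_min_le_volume_nsmul_of_isCompact {K : Set ℝ} (hKc : IsCompact K) {α β : ℝ}
    (hα : α ∈ K) (hβ : β ∈ K) (hαβ : α < β) (hK : K ⊆ Set.Icc α β) (k : ℕ) :
    ENNReal.ofReal (∑ j ∈ Finset.range k, min (β - α) ((j + 1) * (volume K).toReal)) ≤
      volume (k • K) := by
  choose P hPge hP using Nat.exists_infinite_primes
  have hlim : Filter.Tendsto (fun n : ℕ => (β - α) / (P n : ℝ)) Filter.atTop (nhds 0) :=
    (tendsto_natCast_atTop_atTop.comp
      (Filter.tendsto_atTop_mono hPge Filter.tendsto_id)).const_div_atTop _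
  have hthick := (tendsto_measure_cthickening_of_isCompact (μ := volume)
    (hKc.nsmul_set k)).comp (by simpa using hlim.const_mul ((k : ℝ) + 1))
  refine le_of_tendsto_of_tendsto' ?_ hthick
    fun n => sum_min_le_volume_cthickening_nsmul hα hβ hαβ hK k (hP n)
  have hcont : Continuous fun δ : ℝ => ENNReal.ofReal (∑ j ∈ Finset.range k,
      min (β - α) ((j + 1) * ((volume K).toReal - 2 * δ))) :=
    ENNReal.continuous_ofReal.comp (by fun_prop)
  simpa [Function.comp_def] using (hcont.tendsto 0).comp hlim

/-- The bound `|k • A| ≥ ∑_{j=1}^k min(diam A, j |A|)` for bounded measurable sets of reals. -/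
theorem sum_min_le_volume_nsmul {A : Set ℝ} (hAbd : Bornology.IsBounded A) (hA : MeasurableSet A)
    (hA0 : 0 < volume A) (k : ℕ) :
    ENNReal.ofReal (∑ j ∈ Finset.range k,
      min (volume (convexHull ℝ A)).toReal ((j + 1) * (volume A).toReal)) ≤ volume (k • A) := by
  have hAne : A.Nonempty := nonempty_of_measure_ne_zero hA0.ne'
  have hAtop : volume A ≠ ∞ := hAbd.measure_lt_top.ne
  have hm : 0 < (volume A).toReal := ENNReal.toReal_pos hA0.ne' hAtop
  set m := (volume A).toReal
  set D := (volume (convexHull ℝ A)).toReal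
  have hD : D ≤ sSup A - sInf A := by
    have hsub : A ⊆ Set.Icc (sInf A) (sSup A) := fun x hx =>
      ⟨csInf_le hAbd.bddBelow hx, le_csSup hAbd.bddAbove hx⟩
    have hle := hsub hAne.choose_spec
    refine ENNReal.toReal_le_of_le_ofReal (sub_nonneg.2 (hle.1.trans hle.2)) ?_
    rw [← Real.volume_Icc]
    exact measure_mono (convexHull_min hsub (convex_Icc _ _))
  have hmD : m ≤ D := ENNReal.toReal_mono
    ((isBounded_convexHull.2 hAbd).measure_lt_top.ne) (measure_mono (subset_convexHull ℝ A))
  have hbound : ∀ ε ∈ Set.Ioo (0 : ℝ) D, ENNReal.ofReal (∑ j ∈ Finset.range k,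
      min (D - ε) ((j + 1) * (m - ε))) ≤ volume (k • A) := by
    intro ε hε
    obtain ⟨K₀, hK₀A, hK₀c, hK₀⟩ := hA.exists_isCompact_lt_add hAtop
      (ENNReal.ofReal_pos.2 hε.1).ne'
    obtain ⟨a, haA, ha⟩ := exists_lt_of_csInf_lt hAne
      (show sInf A < sInf A + ε / 2 by linarith [hε.1])
    obtain ⟨b, hbA, hb⟩ := exists_lt_of_lt_csSup hAne
      (show sSup A - ε / 2 < sSup A by linarith [hε.1])
    set K : Set ℝ := insert a (insert b K₀)
    have hKc : IsCompact K := (hK₀c.insert b).insert a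
    have hKA : K ⊆ A := Set.insert_subset haA (Set.insert_subset hbA hK₀A)
    have haK : a ∈ K := by simp [K]
    have hbK : b ∈ K := by simp [K]
    have hKsub : K ⊆ Set.Icc (sInf K) (sSup K) := fun x hx =>
      ⟨csInf_le hKc.bddBelow hx, le_csSup hKc.bddAbove hx⟩
    have hKD : D - ε ≤ sSup K - sInf K := by linarith [(hKsub haK).1, (hKsub hbK).2]
    have hKm : m - ε ≤ (volume K).toReal := by
      have hKtop : volume K ≠ ∞ := hKc.measure_lt_top.ne
      have h : volume A ≤ volume K + ENNReal.ofReal ε :=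
        hK₀.le.trans (add_le_add_left (measure_mono fun x hx => by simp [K, hx]) _)
      have h' := ENNReal.toReal_mono (by finiteness) h
      rw [ENNReal.toReal_add hKtop ENNReal.ofReal_ne_top, ENNReal.toReal_ofReal hε.1.le] at h'
      linarith
    refine le_trans (ENNReal.ofReal_le_ofReal ?_)
      ((sum_min_le_volume_nsmul_of_isCompact hKc (hKc.sInf_mem ⟨a, haK⟩) (hKc.sSup_mem ⟨a, haK⟩)
        (by linarith [hε.2]) hKsub k).trans
        (measure_mono (Set.nsmul_subset_nsmul_left hKA)))
    gcongr
  have hcont : Continuous fun ε : ℝ => ENNReal.ofReal (∑ j ∈ Finset.range k,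
      min (D - ε) ((j + 1) * (m - ε))) :=
    ENNReal.continuous_ofReal.comp (by fun_prop)
  have hlim := (hcont.tendsto 0).mono_left (nhdsWithin_le_nhds (s := Set.Ioi 0))
  simp only [sub_zero] at hlim
  exact le_of_tendsto hlim
    (Filter.mem_of_superset (Ioo_mem_nhdsGT (hm.trans_le hmD)) hbound)

theorem le_sum_min {D m : ℝ} (hm : 0 < m) (hD : 0 ≤ D) (k : ℕ) :
    ((min ⌊D / m⌋₊ k * (min ⌊D / m⌋₊ k + 1) / 2 : ℕ) : ℝ) * m +
        ((k - min ⌊D / m⌋₊ k : ℕ) : ℝ) * D ≤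
      ∑ j ∈ Finset.range k, min D ((j + 1) * m) := by
  set ℓ := min ⌊D / m⌋₊ k
  have hℓk : ℓ ≤ k := min_le_right _ _
  rw [← Finset.sum_range_add_sum_Ico _ hℓk]
  refine add_le_add ?_ ?_
  · have hgauss : ((ℓ * (ℓ + 1) / 2 : ℕ) : ℝ) = ∑ j ∈ Finset.range ℓ, ((j : ℝ) + 1) := by
      have h := Finset.sum_range_id (ℓ + 1)
      rw [Finset.sum_range_succ', add_zero, Nat.add_sub_cancel, mul_comm] at h
      rw [← h]
      push_cast
      rfl
    rw [hgauss, Finset.sum_mul]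
    refine Finset.sum_le_sum fun j hj => le_min ?_ le_rfl
    have h : j + 1 ≤ ⌊D / m⌋₊ := (Finset.mem_range.1 hj).trans_le (min_le_left _ _)
    rw [Nat.le_floor_iff (div_nonneg hD hm.le), le_div_iff₀ hm] at h
    exact_mod_cast h
  · rw [← Nat.card_Ico, ← nsmul_eq_mul]
    refine Finset.card_nsmul_le_sum _ _ _ fun j hj => le_min le_rfl ?_
    have hj := Finset.mem_Ico.1 hj
    have h : ⌊D / m⌋₊ < j + 1 := by
      have := hj.1; have := hj.2
      simp only [ℓ] at *
      omega
    rw [Nat.floor_lt (div_nonneg hD hm.le), div_lt_iff₀ hm] at h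
    exact_mod_cast h.le

/-- **Continuous version of Lev's structure theorem for iterated sumsets.**
For `k ≥ 1` and a nonempty bounded measurable `A ⊆ ℝ` of positive measure,
with `ℓ := min{⌊|co(A)|/|A|⌋, k}`, one has
`|k·A| ≥ (ℓ(ℓ+1)/2)|A| + (k - ℓ)|co(A)|`. -/
theorem lev_continuous (k : ℕ) (hk : 1 ≤ k) (A : Set ℝ)
    (hAne : A.Nonempty) (hAbd : Bornology.IsBounded A) (hA : MeasurableSet A)
    (hA0 : 0 < volume A) (ℓ : ℕ)
    (hℓ : ℓ = min ⌊(volume (convexHull ℝ A)).toReal / (volume A).toReal⌋₊ k) :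
    ((ℓ * (ℓ + 1) / 2 : ℕ) : ℝ≥0∞) * volume A +
        ((k - ℓ : ℕ) : ℝ≥0∞) * volume (convexHull ℝ A) ≤
      volume (kSum k A) := by
  have hAtop : volume A ≠ ∞ := hAbd.measure_lt_top.ne
  have hCtop : volume (convexHull ℝ A) ≠ ∞ := (isBounded_convexHull.2 hAbd).measure_lt_top.ne
  have hm : 0 < (volume A).toReal := ENNReal.toReal_pos hA0.ne' hAtop
  rw [kSum_eq_nsmul A hk]
  refine le_trans ?_ (sum_min_le_volume_nsmul hAbd hA hA0 k)
  refine le_trans ?_ (ENNReal.ofReal_le_ofReal (le_sum_min hm ENNReal.toReal_nonneg k))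
  rw [← hℓ, ENNReal.ofReal_add (by positivity) (by positivity),
    ENNReal.ofReal_mul (by positivity), ENNReal.ofReal_mul (by positivity),
    ENNReal.ofReal_toReal hAtop, ENNReal.ofReal_toReal hCtop, ENNReal.ofReal_natCast,
    ENNReal.ofReal_natCast]
end
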